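/- Let d ∈ ℕ and let 𝒫 be a finite family of polytopes in ℝ^d, each of dimension at least one, with 2 ≤ |𝒫| < ∞. Let ρ > 0 and Δ > 0 be such that every P ∈ 𝒫 is contained in the ball ρ·B^d, and for every two distinct P, P' ∈ 𝒫 one has dist(P, P') ≥ Δ. Then max_{P ∈ 𝒫} sxc(P) ≥ (log₂|𝒫| / (8·d·(1 + log₂(2ρ/Δ) + log₂ log₂ |𝒫|)))^{1/4}. -/

import Mathlib

open Metric Set

noncomputable section

/-- A polytope: convex hull of a finite set. -/
def IsPolytope {d : ℕ} (P : Set (EuclideanSpace ℝ (Fin d))) : Prop :=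
  ∃ V : Finset (EuclideanSpace ℝ (Fin d)), P = convexHull ℝ (V : Set (EuclideanSpace ℝ (Fin d)))

/-- `P` has an extended formulation with `l` LMIs of size `m`. -/
def HasSdpExtBlocks {d : ℕ} (P : Set (EuclideanSpace ℝ (Fin d))) (l m : ℕ) : Prop :=
  ∃ (n : ℕ) (φ : EuclideanSpace ℝ (Fin n) →ᵃ[ℝ] EuclideanSpace ℝ (Fin d))
    (M : Fin l → (EuclideanSpace ℝ (Fin n) →ᵃ[ℝ] Matrix (Fin m) (Fin m) ℝ)),
    (∀ i x, (M i x).IsSymm) ∧ P = φ '' {x | ∀ i, (M i x).PosSemidef}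

/-- `P` has an extended formulation with a single LMI of size `k`. -/
def HasSdpExt {d : ℕ} (P : Set (EuclideanSpace ℝ (Fin d))) (k : ℕ) : Prop :=
  ∃ (n : ℕ) (φ : EuclideanSpace ℝ (Fin n) →ᵃ[ℝ] EuclideanSpace ℝ (Fin d))
    (M : EuclideanSpace ℝ (Fin n) →ᵃ[ℝ] Matrix (Fin k) (Fin k) ℝ),
    (∀ x, (M x).IsSymm) ∧ P = φ '' {x | (M x).PosSemidef}

/-- `P` has an extended formulation with `l` linear inequalities. -/
def HasLinExt {d : ℕ} (P : Set (EuclideanSpace ℝ (Fin d))) (l : ℕ) : Prop :=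
  ∃ (n : ℕ) (φ : EuclideanSpace ℝ (Fin n) →ᵃ[ℝ] EuclideanSpace ℝ (Fin d))
    (a : Fin l → (EuclideanSpace ℝ (Fin n) →ᵃ[ℝ] ℝ)),
    P = φ '' {x | ∀ i, 0 ≤ a i x}

open Classical in
/-- Semidefinite extension complexity. -/
def sxc {d : ℕ} (P : Set (EuclideanSpace ℝ (Fin d))) : ℕ :=
  if P = ∅ ∨ ∃ p, P = {p} then 0 else sInf {k | HasSdpExt P k}

open Classical in
/-- Linear extension complexity. -/
def xc {d : ℕ} (P : Set (EuclideanSpace ℝ (Fin d))) : ℕ :=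
  if P = ∅ ∨ ∃ p, P = {p} then 0 else sInf {l | HasLinExt P l}

/-- Spectral norm of a square real matrix (the operator norm of the induced map
on Euclidean space; for a symmetric matrix this is the largest absolute value of
an eigenvalue). -/
def specNorm {ι : Type*} [Fintype ι] [DecidableEq ι] (T : Matrix ι ι ℝ) : ℝ :=
  ‖LinearMap.toContinuousLinearMap (Matrix.toEuclideanLin T)‖

/-- Norm of a linear map into square matrices: the maximum of the spectral norm
of the values over the unit ball. -/
def lmNorm {n : ℕ} {ι : Type*} [Fintype ι] [DecidableEq ι]
    (A : EuclideanSpace ℝ (Fin n) →ₗ[ℝ] Matrix ι ι ℝ) : ℝ :=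
  sSup {r | ∃ x : EuclideanSpace ℝ (Fin n), ‖x‖ ≤ 1 ∧ r = specNorm (A x)}

/-- A 0/1-polytope: the convex hull of a set of 0/1-vectors. -/
def IsZeroOnePolytope {d : ℕ} (P : Set (EuclideanSpace ℝ (Fin d))) : Prop :=
  ∃ V : Set (EuclideanSpace ℝ (Fin d)),
    V ⊆ {x | ∀ i, x i = 0 ∨ x i = 1} ∧ P = convexHull ℝ V


lemma affine_sum {V W : Type*} [AddCommGroup V] [Module ℝ V] [AddCommGroup W] [Module ℝ W]
    (A : V →ᵃ[ℝ] W) {ι : Type*} [Fintype ι] (l : ι → ℝ) (x : ι → V) (h : ∑ i, l i = 1) :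
    A (∑ i, l i • x i) = ∑ i, l i • A (x i) := by
  have hd : ∀ y, A y = A.linear y + A 0 := fun y => congrFun A.decomp y
  rw [hd, map_sum]
  simp_rw [hd (x _), smul_add, Finset.sum_add_distrib, ← Finset.sum_smul, h, one_smul, map_smul]

lemma spanner {W ι : Type*} [AddCommGroup W] [Module ℝ W] [FiniteDimensional ℝ W]
    [Finite ι] [Nonempty ι] (v : ι → W) (n : ℕ) (hn : Module.finrank ℝ W ≤ n) :
    ∃ f : Fin n → ι, ∀ i, ∃ l : Fin n → ℝ, (∀ j, |l j| ≤ 1) ∧ v i = ∑ j, l j • v (f j) := by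
  classical
  obtain ⟨κ, a, ha, hspan, hli⟩ := exists_linearIndependent' ℝ v
  let U := Submodule.span ℝ (range v)
  have hvU : ∀ i, v i ∈ U := fun i => Submodule.subset_span ⟨i, rfl⟩
  let v' : ι → U := fun i => ⟨v i, hvU i⟩
  have hli' : LinearIndependent ℝ (fun i => v' (a i)) := by
    apply LinearIndependent.of_comp U.subtype
    exact hli
  have : Finite κ := Finite.of_injective a ha
  have hsp' : ⊤ ≤ Submodule.span ℝ (range (fun i => v' (a i))) := by
    rintro ⟨x, hx⟩ -
    have hx2 : x ∈ Submodule.span ℝ (range (v ∘ a)) := by rw [hspan]; exact hx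
    have hm : Submodule.map U.subtype (Submodule.span ℝ (range (fun i => v' (a i))))
        = Submodule.span ℝ (range (v ∘ a)) := by
      rw [Submodule.map_span, ← range_comp]; rfl
    rw [← hm] at hx2
    obtain ⟨y, hy, hyx⟩ := hx2
    have : y = ⟨x, hx⟩ := Subtype.ext hyx
    rwa [← this]
  let b0 := Module.Basis.mk hli' hsp'
  let m := Module.finrank ℝ U
  have : Fintype κ := Fintype.ofFinite κ
  have hcard : Fintype.card κ = m := (Module.finrank_eq_card_basis b0).symm
  let e0 : κ ≃ Fin m := Fintype.equivFinOfCardEq hcard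
  let e := b0.reindex e0
  have hg0 : e.det (fun j => v' (a (e0.symm j))) ≠ 0 := by
    have : (fun j => v' (a (e0.symm j))) = e := by
      ext j; simp [e, b0]
    rw [this, e.det_self]; exact one_ne_zero
  obtain ⟨g, hg⟩ := Finite.exists_max (fun g : Fin m → ι => |e.det (fun j => v' (g j))|)
  have hD : 0 < |e.det (fun j => v' (g j))| := lt_of_lt_of_le (abs_pos.mpr hg0) (hg _)
  have hb := (Module.Basis.is_basis_iff_det e (v := fun j => v' (g j))).mpr
    (isUnit_iff_ne_zero.mpr (abs_pos.mp hD))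
  let b := Module.Basis.mk hb.1 hb.2.ge
  have hbj : ∀ j, b j = v' (g j) := fun j => by simp [b]
  have key : ∀ i j, |b.repr (v' i) j| ≤ 1 := by
    intro i j
    have h1 : e.det (Function.update (fun j => v' (g j)) j (v' i))
        = b.repr (v' i) j * e.det (fun j => v' (g j)) := by
      conv_lhs => rw [← b.sum_repr (v' i)]
      rw [AlternatingMap.map_update_sum]
      rw [Finset.sum_eq_single j]
      · rw [AlternatingMap.map_update_smul, hbj, Function.update_eq_self j (fun j => v' (g j)), smul_eq_mul]
      · intro c _ hc
        rw [AlternatingMap.map_update_smul, hbj]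
        rw [AlternatingMap.map_update_self _ _ hc.symm, smul_zero]
      · simp
    have h2 : Function.update (fun j => v' (g j)) j (v' i) = fun j' => v' (Function.update g j i j') := by
      ext j'
      by_cases h : j' = j
      · subst h; simp
      · simp [h]
    have h3 := hg (Function.update g j i)
    rw [← h2, h1, abs_mul] at h3
    nlinarith
  have hmn : m ≤ n := (Submodule.finrank_le U).trans hn
  obtain ⟨r, rfl⟩ := Nat.exists_eq_add_of_le hmn
  refine ⟨Fin.append g (fun _ => Classical.arbitrary ι), fun i =>
    ⟨Fin.append (fun j => b.repr (v' i) j) (fun _ => 0), ?_, ?_⟩⟩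
  · intro j
    refine Fin.addCases (fun j => ?_) (fun j => ?_) j
    · simpa using key i j
    · simp
  · rw [Fin.sum_univ_add]
    simp only [Fin.append_left, Fin.append_right, zero_smul, Finset.sum_const_zero, add_zero]
    have := congrArg (U.subtype) (b.sum_repr (v' i))
    rw [map_sum] at this
    simp only [hbj, map_smul] at this
    exact this.symm

lemma normalize_psd {n k : ℕ} (hn : 0 < n) (M : Fin n → Matrix (Fin k) (Fin k) ℝ)
    (hM : ∀ i, (M i).PosSemidef) :
    ∃ N : Fin n → Matrix (Fin k) (Fin k) ℝ, (∀ i, (N i).PosSemidef) ∧ ∑ i, N i = 1 ∧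
      ∀ l : Fin n → ℝ, ∑ i, l i = 1 →
        ((∑ i, l i • M i).PosSemidef ↔ (∑ i, l i • N i).PosSemidef) := by
  classical
  have hS : (∑ i, M i).PosSemidef := Matrix.posSemidef_sum _ (fun i _ => hM i)
  obtain ⟨G, H, hG, hH, hHG, hGH, hGSG, hSP, hHPH, hP⟩ : ∃ G H : Matrix (Fin k) (Fin k) ℝ,
      G.conjTranspose = G ∧ H.conjTranspose = H ∧ H * G = G * H ∧ True ∧
      G * (∑ i, M i) * G = G * H ∧ (∑ i, M i) * (1 - G * H) = 0 ∧ H * (1 - G * H) = 0 ∧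
      (1 - G * H).PosSemidef := by
    set S := ∑ i, M i
    let U : Matrix (Fin k) (Fin k) ℝ := hS.1.eigenvectorUnitary
    have hUU : star U * U = 1 := Unitary.coe_star_mul_self hS.1.eigenvectorUnitary
    have hUU' : U * star U = 1 := Unitary.coe_mul_star_self hS.1.eigenvectorUnitary
    let e := hS.1.eigenvalues
    have he : ∀ i, 0 ≤ e i := hS.eigenvalues_nonneg
    have hSe : S = U * Matrix.diagonal e * star U := by
      have := hS.1.spectral_theorem
      rw [Unitary.conjStarAlgAut_apply] at this
      exact this
    have mulC : ∀ x y : Fin k → ℝ, (U * Matrix.diagonal x * star U) * (U * Matrix.diagonal y * star U)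
        = U * Matrix.diagonal (x * y) * star U := by
      intro x y
      have : (U * Matrix.diagonal x * star U) * (U * Matrix.diagonal y * star U)
        = U * Matrix.diagonal x * (star U * U) * Matrix.diagonal y * star U := by
          simp only [Matrix.mul_assoc]
      rw [this, hUU, Matrix.mul_one, Matrix.mul_assoc U, Matrix.diagonal_mul_diagonal]
      rfl
    have oneC : (1 : Matrix (Fin k) (Fin k) ℝ) = U * Matrix.diagonal 1 * star U := by
      rw [show Matrix.diagonal (1 : Fin k → ℝ) = 1 from Matrix.diagonal_one, Matrix.mul_one, hUU']
    have subC : ∀ x y : Fin k → ℝ, (U * Matrix.diagonal x * star U) - (U * Matrix.diagonal y * star U)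
        = U * Matrix.diagonal (x - y) * star U := by
      intro x y
      rw [← Matrix.sub_mul, ← Matrix.mul_sub, Matrix.diagonal_sub]; rfl
    have starC : ∀ x : Fin k → ℝ, (U * Matrix.diagonal x * star U).conjTranspose
        = U * Matrix.diagonal x * star U := by
      intro x
      simp [Matrix.conjTranspose_mul, Matrix.star_eq_conjTranspose, Matrix.mul_assoc]
    have psdC : ∀ x : Fin k → ℝ, (∀ i, 0 ≤ x i) → (U * Matrix.diagonal x * star U).PosSemidef := by
      intro x hx
      exact (Matrix.PosSemidef.diagonal hx).mul_mul_conjTranspose_same U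
    let g : Fin k → ℝ := fun i => (√(e i))⁻¹
    let h : Fin k → ℝ := fun i => √(e i)
    have hgh : ∀ i, (g i * h i = 1) ∨ (g i * h i = 0 ∧ e i = 0 ∧ h i = 0 ∧ g i = 0) := by
      intro i
      by_cases h0 : e i = 0
      · right; simp [g, h, h0]
      · left
        have : √(e i) ≠ 0 := by
          rw [Real.sqrt_ne_zero (he i)]; exact h0
        simp [g, h, this]
    have hee : ∀ i, e i = h i * h i := fun i => (Real.mul_self_sqrt (he i)).symm
    have zeroC : (0 : Matrix (Fin k) (Fin k) ℝ) = U * Matrix.diagonal 0 * star U := by simp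
    refine ⟨U * Matrix.diagonal g * star U, U * Matrix.diagonal h * star U, starC _, starC _, ?_,
      trivial, ?_, ?_, ?_, ?_⟩
    · rw [mulC, mulC, mul_comm]
    · rw [hSe, mulC, mulC, mulC]
      congr 3
      ext i
      have := hee i
      rcases hgh i with h1 | h1
      · simp only [Pi.mul_apply]; rw [this]
        linear_combination (g i * h i) * h1
      · simp [h1]
    · rw [hSe, mulC, oneC, subC, mulC]
      rw [zeroC]
      congr 3
      ext i
      rcases hgh i with h1 | h1
      · simp [h1]
      · simp [h1]
    · rw [mulC, oneC, subC, mulC]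
      rw [zeroC]
      congr 3
      ext i
      rcases hgh i with h1 | h1
      · simp [h1]
      · simp [h1]
    · rw [mulC, oneC, subC]
      apply psdC
      intro i
      rcases hgh i with h1 | h1
      · simp [h1]
      · simp [h1]
  set Q := 1 - G * H with hQ
  have hQs : Q.conjTranspose = Q := hP.1
  have hMQ : ∀ i, M i * Q = 0 := by
    intro i
    have hz : ∑ i, (Q.conjTranspose * M i * Q) = 0 := by
      rw [← Matrix.sum_mul, ← Matrix.mul_sum, Matrix.mul_assoc, hSP, Matrix.mul_zero]
    have hps : ∀ i, (Q.conjTranspose * M i * Q).PosSemidef :=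
      fun i => (hM i).conjTranspose_mul_mul_same Q
    have htr : ∑ i, (Q.conjTranspose * M i * Q).trace = 0 := by
      rw [← Matrix.trace_sum, hz, Matrix.trace_zero]
    have := (Finset.sum_eq_zero_iff_of_nonneg (fun i _ => (hps i).trace_nonneg)).mp htr i (Finset.mem_univ _)
    have h0 := (hps i).trace_eq_zero_iff.mp this
    ext a c
    have h1 : star (Q.col c) ⬝ᵥ ((M i).mulVec (Q.col c)) = 0 := by
      have := congrFun (congrFun h0 c) c
      rw [Matrix.mul_assoc, Matrix.mul_apply] at this
      simpa [dotProduct, Matrix.mulVec, Matrix.mul_apply, Matrix.conjTranspose_apply] using this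
    have h2 := ((hM i).dotProduct_mulVec_zero_iff _).mp h1
    have := congrFun h2 a
    simpa [Matrix.mul_apply, Matrix.mulVec, dotProduct] using this
  have hQM : ∀ i, Q * M i = 0 := by
    intro i
    have := congrArg Matrix.conjTranspose (hMQ i)
    rwa [Matrix.conjTranspose_mul, hQs, (hM i).1, Matrix.conjTranspose_zero] at this
  have hn' : (n : ℝ) ≠ 0 := by exact_mod_cast hn.ne'
  have hsum : ∀ l : Fin n → ℝ, ∑ i, l i = 1 → 
      ∑ i, l i • (G * M i * G + (n : ℝ)⁻¹ • Q) = G * (∑ i, l i • M i) * G + (n : ℝ)⁻¹ • Q := by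
    intro l hl
    simp_rw [smul_add, Finset.sum_add_distrib, ← Finset.sum_smul, hl, one_smul, Matrix.mul_sum,
      Matrix.sum_mul]
    simp
  have hQn : ((n : ℝ)⁻¹ • Q).PosSemidef := hP.smul (by positivity)
  have hconj : ∀ A : Matrix (Fin k) (Fin k) ℝ, A.PosSemidef → (G * A * G).PosSemidef := by
    intro A hA
    have := hA.mul_mul_conjTranspose_same G
    rwa [hG] at this
  refine ⟨fun i => G * M i * G + (n : ℝ)⁻¹ • Q, fun i => (hconj _ (hM i)).add hQn, ?_, ?_⟩
  · rw [Finset.sum_add_distrib, ← Matrix.sum_mul, ← Matrix.mul_sum, hGSG]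
    simp [← Nat.cast_smul_eq_nsmul ℝ, smul_smul, hn', hQ]
  · intro l hl
    rw [hsum l hl]
    constructor
    · intro h
      exact (hconj _ h).add hQn
    · intro h
      have h2 := h.mul_mul_conjTranspose_same H
      rw [hH] at h2
      convert h2 using 1
      set A := ∑ i, l i • M i
      have hAQ : A * Q = 0 := by
        simp only [A, Matrix.sum_mul, Matrix.smul_mul, hMQ, smul_zero, Finset.sum_const_zero]
      have hQA : Q * A = 0 := by
        simp only [A, Matrix.mul_sum, Matrix.mul_smul, hQM, smul_zero, Finset.sum_const_zero]
      have e1 : A * (G * H) = A := by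
        have : G * H = 1 - Q := by rw [hQ]; abel
        rw [this, Matrix.mul_sub, hAQ, Matrix.mul_one, sub_zero]
      have e2 : (G * H) * A = A := by
        have : G * H = 1 - Q := by rw [hQ]; abel
        rw [this, Matrix.sub_mul, hQA, Matrix.one_mul, sub_zero]
      rw [Matrix.mul_add, Matrix.add_mul, Matrix.mul_smul, Matrix.smul_mul, hHPH]
      simp only [Matrix.zero_mul, smul_zero, add_zero]
      calc A = (H * G) * (A * (G * H)) := by rw [e1, hHG, e2]
        _ = _ := by simp only [Matrix.mul_assoc]

lemma bounded_line {E : Type*} [NormedAddCommGroup E] [NormedSpace ℝ E] (a c : E) (ρ : ℝ)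
    (h : ∀ t : ℝ, ‖t • c + a‖ ≤ ρ) : c = 0 := by
  by_contra hc
  have hc' : 0 < ‖c‖ := norm_pos_iff.mpr hc
  have h1 := h ((ρ + ‖a‖ + 1) / ‖c‖)
  have h0 := h 0
  have hρ : 0 ≤ ρ := (norm_nonneg _).trans h0
  have h2 : ‖((ρ + ‖a‖ + 1) / ‖c‖) • c‖ = ρ + ‖a‖ + 1 := by
    rw [norm_smul, Real.norm_of_nonneg (by positivity)]
    field_simp
  have h3 := norm_sub_le (((ρ + ‖a‖ + 1) / ‖c‖) • c + a) a
  rw [add_sub_cancel_right, h2] at h3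
  linarith

lemma kernel_eq {d n k : ℕ} (φ : EuclideanSpace ℝ (Fin n) →ᵃ[ℝ] EuclideanSpace ℝ (Fin d))
    (M : EuclideanSpace ℝ (Fin n) →ᵃ[ℝ] Matrix (Fin k) (Fin k) ℝ) (ρ : ℝ)
    (hb : φ '' {x | (M x).PosSemidef} ⊆ closedBall 0 ρ) (x y : EuclideanSpace ℝ (Fin n))
    (hxy : M x = M y) (hx : (M x).PosSemidef) : φ x = φ y := by
  have : φ y - φ x = 0 := by
    apply bounded_line (φ x) _ ρ
    intro t
    have h1 : φ (AffineMap.lineMap x y t) ∈ closedBall (0 : EuclideanSpace ℝ (Fin d)) ρ := by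
      apply hb
      refine ⟨_, ?_, rfl⟩
      simp only [mem_setOf_eq]
      rw [AffineMap.apply_lineMap, ← hxy, AffineMap.lineMap_same_apply]
      exact hx
    rw [AffineMap.apply_lineMap, AffineMap.lineMap_apply, vsub_eq_sub, vadd_eq_add] at h1
    simpa using h1
  exact (sub_eq_zero.mp this).symm

/-- A normalized description of `P`. -/
structure Descr {d : ℕ} (P : Set (EuclideanSpace ℝ (Fin d))) (k n : ℕ)
    (N : Fin n → Matrix (Fin k) (Fin k) ℝ) (p : Fin n → EuclideanSpace ℝ (Fin d)) : Prop where
  psd : ∀ i, (N i).PosSemidef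
  sum_one : ∑ i, N i = 1
  out : ∀ x ∈ P, ∃ l : Fin n → ℝ, (∀ i, |l i| ≤ 1) ∧ ∑ i, l i = 1 ∧ (∑ i, l i • N i).PosSemidef ∧
    x = ∑ i, l i • p i
  inn : ∀ l : Fin n → ℝ, ∑ i, l i = 1 → (∑ i, l i • N i).PosSemidef → ∑ i, l i • p i ∈ P
  mem : ∀ i, p i ∈ P

lemma exists_descr {d k : ℕ} (P : Set (EuclideanSpace ℝ (Fin d))) (ρ : ℝ) (hP : IsPolytope P)
    (hne : P.Nonempty) (hb : P ⊆ closedBall 0 ρ) (h : HasSdpExt P k) :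
    ∃ N p, Descr P k (k * k + 1) N p := by
  classical
  obtain ⟨V, hV⟩ := hP
  obtain ⟨m, φ, M, hsymm, hPM⟩ := h
  have hVP : ∀ v : V, (v : EuclideanSpace ℝ (Fin d)) ∈ P := fun v => by
    rw [hV]; exact subset_convexHull _ _ v.2
  have hlift : ∀ v : V, ∃ x, (M x).PosSemidef ∧ φ x = v := by
    intro v
    have := hVP v
    rw [hPM] at this
    exact this
  choose X hX hφX using hlift
  have hVne : Nonempty V := by
    rw [hV, convexHull_nonempty_iff] at hne
    exact hne.to_subtype
  obtain ⟨f, hf⟩ := spanner (W := Matrix (Fin k) (Fin k) ℝ × ℝ) (fun v : V => (M (X v), (1 : ℝ)))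
    (k * k + 1) (by simp [Module.finrank_matrix])
  obtain ⟨N, hN, hN1, hiff⟩ := normalize_psd (Nat.succ_pos (k * k)) (fun i => M (X (f i)))
    (fun i => hX _)
  have hinn : ∀ l : Fin (k * k + 1) → ℝ, ∑ i, l i = 1 → (∑ i, l i • N i).PosSemidef →
      ∑ i, l i • (f i : EuclideanSpace ℝ (Fin d)) ∈ P := by
    intro l hl hps
    rw [← hiff l hl, ← affine_sum M l _ hl] at hps
    rw [hPM]
    refine ⟨_, hps, ?_⟩
    rw [affine_sum φ l _ hl]
    simp only [hφX]
  refine ⟨N, fun i => f i, hN, hN1, ?_, hinn, fun i => hVP _⟩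
  suffices hsub : P ⊆ {x | ∃ l : Fin (k * k + 1) → ℝ, (∀ i, |l i| ≤ 1) ∧ ∑ i, l i = 1 ∧
      (∑ i, l i • N i).PosSemidef ∧ x = ∑ i, l i • (f i : EuclideanSpace ℝ (Fin d))} from
    fun x hx => hsub hx
  nth_rewrite 1 [hV]
  apply convexHull_min
  · intro v hv
    obtain ⟨l, hl1, hl2⟩ := hf ⟨v, hv⟩
    have hs : ∑ i, l i = 1 := by
      have := congrArg Prod.snd hl2
      simpa [Prod.snd_sum] using this.symm
    have hMs : M (X ⟨v, hv⟩) = ∑ i, l i • M (X (f i)) := by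
      have := congrArg Prod.fst hl2
      simpa [Prod.fst_sum] using this
    refine ⟨l, hl1, hs, ?_, ?_⟩
    · rw [← hiff l hs, ← hMs]; exact hX _
    · rw [← affine_sum M l _ hs] at hMs
      have := kernel_eq φ M ρ (hPM ▸ hb) _ _ hMs (hX _)
      rw [affine_sum φ l _ hs] at this
      simpa only [hφX] using this
  · rintro x ⟨l, h1, h2, h3, rfl⟩ y ⟨l', h1', h2', h3', rfl⟩ a c ha hc hac
    refine ⟨fun i => a * l i + c * l' i, ?_, ?_, ?_, ?_⟩
    · intro i
      have := abs_le.mp (h1 i)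
      have := abs_le.mp (h1' i)
      rw [abs_le]
      constructor <;> nlinarith
    · rw [Finset.sum_add_distrib, ← Finset.mul_sum, ← Finset.mul_sum, h2, h2']; simpa using hac
    · have := (h3.smul ha).add (h3'.smul hc)
      simpa only [add_smul, mul_smul, Finset.sum_add_distrib, ← Finset.smul_sum] using this
    · simp only [add_smul, mul_smul, Finset.sum_add_distrib, ← Finset.smul_sum]

lemma entry_le {d k n : ℕ} {P : Set (EuclideanSpace ℝ (Fin d))}
    {N : Fin n → Matrix (Fin k) (Fin k) ℝ} {p : Fin n → EuclideanSpace ℝ (Fin d)}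
    (h : Descr P k n N p) (i : Fin n) (a b : Fin k) : |N i a b| ≤ 1 := by
  have hdiag : ∀ a, 0 ≤ N i a a ∧ N i a a ≤ 1 := by
    intro a
    have h0 : ∀ j, 0 ≤ N j a a := fun j => (h.psd j).diag_nonneg
    refine ⟨h0 i, ?_⟩
    have h1 := congrFun (congrFun h.sum_one a) a
    rw [Matrix.sum_apply, Matrix.one_apply_eq] at h1
    rw [← h1]
    exact Finset.single_le_sum (f := fun j => N j a a) (fun j _ => h0 j) (Finset.mem_univ i)
  by_cases hab : a = b
  · subst hab
    rw [abs_of_nonneg (hdiag a).1]; exact (hdiag a).2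
  have hs : N i b a = N i a b := by
    have := congrFun (congrFun (h.psd i).1 a) b
    simpa using this
  have hp := (h.psd i).dotProduct_mulVec_nonneg (Pi.single a 1 + Pi.single b 1)
  have hm := (h.psd i).dotProduct_mulVec_nonneg (Pi.single a 1 - Pi.single b 1)
  simp [Matrix.mulVec_add, Matrix.mulVec_sub, add_dotProduct, sub_dotProduct, hs] at hp hm
  have := hdiag a
  have := hdiag b
  rw [abs_le]
  constructor <;> linarith

lemma quad_bound {k : ℕ} (E : Matrix (Fin k) (Fin k) ℝ) (c : ℝ) (hE : ∀ a b, |E a b| ≤ c)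
    (x : Fin k → ℝ) : -(c * k * ∑ a, x a ^ 2) ≤ x ⬝ᵥ E.mulVec x := by
  have h1 : x ⬝ᵥ E.mulVec x = ∑ a, ∑ b, x a * (E a b * x b) := by
    simp [dotProduct, Matrix.mulVec, Finset.mul_sum]
  have h2 : ∀ a b, -(c * ((x a ^ 2 + x b ^ 2) / 2)) ≤ x a * (E a b * x b) := by
    intro a b
    have hc := hE a b
    have : |x a * (E a b * x b)| ≤ c * ((x a ^ 2 + x b ^ 2) / 2) := by
      have e : |x a * (E a b * x b)| = |E a b| * (|x a| * |x b|) := by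
        rw [abs_mul, abs_mul]; ring
      rw [e]
      have hc0 : 0 ≤ c := (abs_nonneg _).trans hc
      apply mul_le_mul hc _ (by positivity) hc0
      nlinarith [sq_nonneg (|x a| - |x b|), sq_abs (x a), sq_abs (x b)]
    exact (abs_le.mp this).1
  rw [h1]
  calc -(c * k * ∑ a, x a ^ 2) = ∑ a, ∑ b, -(c * ((x a ^ 2 + x b ^ 2) / 2)) := by
        simp only [Finset.sum_neg_distrib, ← Finset.mul_sum, ← Finset.sum_div,
          Finset.sum_add_distrib, Finset.sum_const, Finset.card_univ, Fintype.card_fin,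
          nsmul_eq_mul]
        ring
    _ ≤ _ := Finset.sum_le_sum fun a _ => Finset.sum_le_sum fun b _ => h2 a b

lemma close_points {d k n : ℕ} (hn : 0 < n) {P P' : Set (EuclideanSpace ℝ (Fin d))}
    {N N' : Fin n → Matrix (Fin k) (Fin k) ℝ} {p p' : Fin n → EuclideanSpace ℝ (Fin d)}
    (h : Descr P k n N p) (h' : Descr P' k n N' p') (ρ η θ : ℝ)
    (hb : P ⊆ closedBall 0 ρ) (hb' : P' ⊆ closedBall 0 ρ) (hη : 0 ≤ η) (hθ : 0 ≤ θ)
    (hN : ∀ i a b, |N' i a b - N i a b| ≤ η) (hp : ∀ i, dist (p i) (p' i) ≤ θ)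
    (ht1 : (n : ℝ) ^ 2 * k * η ≤ 1) :
    ∀ x ∈ P, ∃ y ∈ P', dist x y ≤ n * θ + 2 * ρ * (n ^ 2 * k * η) := by
  intro x hx
  obtain ⟨l, hl1, hls, hlp, hxl⟩ := h.out x hx
  set t : ℝ := (n : ℝ) ^ 2 * k * η with ht
  have ht0 : 0 ≤ t := by positivity
  have hnR : (0 : ℝ) < n := by exact_mod_cast hn
  let μ : Fin n → ℝ := fun i => (1 - t) * l i + t / n
  have hμ : ∑ i, μ i = 1 := by
    simp only [μ, Finset.sum_add_distrib, ← Finset.mul_sum, hls, Finset.sum_const,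
      Finset.card_univ, Fintype.card_fin, nsmul_eq_mul]
    field_simp; ring
  have hsum : ∑ i, μ i • N' i = (1 - t) • (∑ i, l i • N i) + (1 - t) • (∑ i, l i • (N' i - N i))
      + (t / n) • (1 : Matrix (Fin k) (Fin k) ℝ) := by
    rw [← h'.sum_one]
    simp only [μ, add_smul, mul_smul, Finset.sum_add_distrib, ← Finset.smul_sum, smul_sub,
      Finset.sum_sub_distrib]
    abel
  have hE : ∀ a b, |(∑ i, l i • (N' i - N i)) a b| ≤ n * η := by
    intro a b
    rw [Matrix.sum_apply]
    calc _ ≤ ∑ i, |(l i • (N' i - N i)) a b| := Finset.abs_sum_le_sum_abs _ _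
      _ ≤ ∑ i : Fin n, η := by
        apply Finset.sum_le_sum
        intro i _
        rw [Matrix.smul_apply, Matrix.sub_apply, smul_eq_mul, abs_mul]
        calc _ ≤ 1 * η := mul_le_mul (hl1 i) (hN i a b) (abs_nonneg _) zero_le_one
          _ = η := one_mul _
      _ = n * η := by simp
  have hps : (∑ i, μ i • N' i).PosSemidef := by
    apply Matrix.PosSemidef.of_dotProduct_mulVec_nonneg
    · have hh : ∀ i, (N' i).IsHermitian := fun i => (h'.psd i).1
      unfold Matrix.IsHermitian
      rw [Matrix.conjTranspose_sum]
      refine Finset.sum_congr rfl fun i _ => ?_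
      rw [Matrix.conjTranspose_smul, hh i]; simp
    · intro z
      rw [hsum]
      have q1 := hlp.dotProduct_mulVec_nonneg z
      have q2 := quad_bound _ _ hE z
      rw [star_trivial] at q1 ⊢
      simp only [Matrix.add_mulVec, Matrix.smul_mulVec, dotProduct_add, dotProduct_smul,
        Matrix.one_mulVec, smul_eq_mul]
      have q3 : z ⬝ᵥ z = ∑ a, z a ^ 2 := by simp [dotProduct, sq]
      rw [q3]
      set s := ∑ a, z a ^ 2
      have hs : 0 ≤ s := Finset.sum_nonneg fun a _ => sq_nonneg _
      have q4 : t / n = n * η * k := by rw [ht]; field_simp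
      rw [q4]
      have r1 := mul_nonneg (sub_nonneg.mpr ht1) q1
      have r2 := mul_le_mul_of_nonneg_left q2 (sub_nonneg.mpr ht1)
      have r3 : 0 ≤ t * (n * η * k * s) := by positivity
      nlinarith
  refine ⟨_, h'.inn μ hμ hps, ?_⟩
  have hconst : ∑ i : Fin n, (1 / (n : ℝ)) = 1 := by
    simp; field_simp
  have havg : ∑ i, (1 / (n : ℝ)) • p' i ∈ P' := by
    apply h'.inn _ hconst
    rw [← Finset.smul_sum, h'.sum_one]
    exact Matrix.PosSemidef.one.smul (by positivity)
  have e : x - ∑ i, μ i • p' i = (1 - t) • (∑ i, l i • (p i - p' i))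
      + t • (x - ∑ i, (1 / (n : ℝ)) • p' i) := by
    nth_rewrite 1 [show x = (1 - t) • x + t • x by rw [← add_smul]; simp]
    have e2 : ∑ i, μ i • p' i = (1 - t) • ∑ i, l i • p' i + t • ∑ i, (1 / (n : ℝ)) • p' i := by
      simp only [μ, add_smul, Finset.sum_add_distrib, Finset.smul_sum, smul_smul, mul_one_div]
    have e3 : ∑ i, l i • (p i - p' i) = x - ∑ i, l i • p' i := by
      rw [hxl]; simp only [smul_sub, Finset.sum_sub_distrib]
    rw [e2, e3, smul_sub, smul_sub]; abel
  rw [dist_eq_norm, e]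
  have n1 : ‖∑ i, l i • (p i - p' i)‖ ≤ n * θ := by
    calc _ ≤ ∑ i, ‖l i • (p i - p' i)‖ := norm_sum_le _ _
      _ ≤ ∑ i : Fin n, θ := by
        apply Finset.sum_le_sum
        intro i _
        rw [norm_smul, Real.norm_eq_abs, ← dist_eq_norm]
        calc _ ≤ 1 * θ := mul_le_mul (hl1 i) (hp i) dist_nonneg zero_le_one
          _ = θ := one_mul _
      _ = n * θ := by simp
  have n2 : ‖x - ∑ i, (1 / (n : ℝ)) • p' i‖ ≤ 2 * ρ := by
    have a1 := hb hx
    have a2 := hb' havg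
    rw [mem_closedBall_zero_iff] at a1 a2
    exact (norm_sub_le _ _).trans (by linarith)
  calc _ ≤ ‖(1 - t) • (∑ i, l i • (p i - p' i))‖ + ‖t • (x - ∑ i, (1 / (n : ℝ)) • p' i)‖ :=
        norm_add_le _ _
    _ ≤ 1 * (n * θ) + t * (2 * ρ) := by
        rw [norm_smul, norm_smul, Real.norm_of_nonneg ht0,
          Real.norm_of_nonneg (sub_nonneg.mpr ht1)]
        gcongr
        linarith
    _ = _ := by ring

lemma sdpExt_mono {d k K : ℕ} {P : Set (EuclideanSpace ℝ (Fin d))} (hk : k ≤ K)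
    (h : HasSdpExt P k) : HasSdpExt P K := by
  classical
  obtain ⟨n, φ, M, hs, hP⟩ := h
  let E : Matrix (Fin K) (Fin k) ℝ := Matrix.of fun i j => if i = Fin.castLE hk j then 1 else 0
  have hE : E.transpose * E = 1 := by
    ext a b
    simp [Matrix.mul_apply, E, Matrix.one_apply, eq_comm]
  let L : Matrix (Fin k) (Fin k) ℝ →ₗ[ℝ] Matrix (Fin K) (Fin K) ℝ :=
    { toFun := fun A => E * A * E.transpose
      map_add' := fun A B => by rw [Matrix.mul_add, Matrix.add_mul]
      map_smul' := fun c A => by simp }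
  refine ⟨n, φ, L.toAffineMap.comp M, ?_, ?_⟩
  · intro x
    change (E * M x * E.transpose).transpose = E * M x * E.transpose
    rw [Matrix.transpose_mul, Matrix.transpose_mul, Matrix.transpose_transpose, (hs x).eq,
      Matrix.mul_assoc]
  · rw [hP]
    congr 1
    ext x
    change (M x).PosSemidef ↔ (E * M x * E.transpose).PosSemidef
    rw [← Matrix.conjTranspose_eq_transpose_of_trivial] at hE ⊢
    constructor
    · intro h; exact h.mul_mul_conjTranspose_same E
    · intro h
      have h2 := h.conjTranspose_mul_mul_same E
      have : E.conjTranspose * (E * M x * E.conjTranspose) * E = M x := by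
        calc _ = (E.conjTranspose * E) * M x * (E.conjTranspose * E) := by
              simp only [Matrix.mul_assoc]
          _ = _ := by rw [hE]; simp
      rwa [this] at h2

lemma polytope_sdpExt {d : ℕ} {P : Set (EuclideanSpace ℝ (Fin d))} (h : IsPolytope P) :
    ∃ k, HasSdpExt P k := by
  classical
  obtain ⟨V, hV⟩ := h
  let m := Fintype.card V
  let e : Fin m ≃ V := (Fintype.equivFin V).symm
  let φ : EuclideanSpace ℝ (Fin m) →ₗ[ℝ] EuclideanSpace ℝ (Fin d) :=
    ∑ i, LinearMap.smulRight (EuclideanSpace.proj i : EuclideanSpace ℝ (Fin m) →L[ℝ] ℝ).toLinearMap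
      (e i : EuclideanSpace ℝ (Fin d))
  have hφ : ∀ x, φ x = ∑ i, x i • (e i : EuclideanSpace ℝ (Fin d)) := by
    intro x; simp [φ]
  let D : EuclideanSpace ℝ (Fin m) →ₗ[ℝ] Matrix (Fin (m + 2)) (Fin (m + 2)) ℝ :=
    { toFun := fun x => Matrix.diagonal (Fin.append (fun i => x i) ![∑ i, x i, - ∑ i, x i])
      map_add' := by
        intro x y
        rw [Matrix.diagonal_add]
        congr 1
        ext j
        refine Fin.addCases (fun j => ?_) (fun j => ?_) j
        · simp
        · fin_cases j <;> simp [Finset.sum_add_distrib]; ring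
      map_smul' := by
        intro c x
        rw [RingHom.id_apply, ← Matrix.diagonal_smul]
        congr 1
        ext j
        refine Fin.addCases (fun j => ?_) (fun j => ?_) j
        · simp
        · fin_cases j <;> simp [Finset.mul_sum] }
  let c : Matrix (Fin (m + 2)) (Fin (m + 2)) ℝ :=
    Matrix.diagonal (Fin.append (fun _ : Fin m => 0) ![-1, 1])
  let A : EuclideanSpace ℝ (Fin m) →ᵃ[ℝ] Matrix (Fin (m + 2)) (Fin (m + 2)) ℝ :=
    D.toAffineMap + AffineMap.const ℝ _ c
  have hA : ∀ x, A x = Matrix.diagonal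
      (Fin.append (fun i => x i) ![∑ i, x i, - ∑ i, x i] + Fin.append (fun _ : Fin m => 0) ![-1, 1]) := by
    intro x
    change D x + c = _
    simp only [D, c, LinearMap.coe_mk, AddHom.coe_mk]
    rw [Matrix.diagonal_add]; rfl
  refine ⟨m + 2, m, φ.toAffineMap, A, ?_, ?_⟩
  · intro x
    rw [hA]; exact Matrix.isSymm_diagonal _
  · ext y
    rw [hV, Finset.mem_convexHull']
    simp only [mem_image, mem_setOf_eq, hA, Matrix.posSemidef_diagonal_iff,
      LinearMap.coe_toAffineMap, hφ]
    constructor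
    · rintro ⟨w, hw0, hw1, hw⟩
      have hre : ∀ {β : Type} [AddCommMonoid β] (g : EuclideanSpace ℝ (Fin d) → β), 
          ∑ i, g (e i) = ∑ v ∈ V, g v := by
        intro β _ g
        rw [e.sum_comp (fun v : V => g v), Finset.sum_coe_sort]
      refine ⟨WithLp.toLp 2 (fun i => w (e i)), ?_, ?_⟩
      · intro j
        refine Fin.addCases (fun j => ?_) (fun j => ?_) j
        · simpa using hw0 _ (e j).2
        · have h1 : ∑ i, w (e i) = 1 := (hre w).trans hw1
          fin_cases j <;> simp [h1]
      · rw [← hw, ← hre]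
    · rintro ⟨x, hx, rfl⟩
      have hs : ∑ i, x i = 1 := by
        have h1 := hx (Fin.natAdd m 0)
        have h2 := hx (Fin.natAdd m 1)
        simp at h1 h2
        linarith
      have hn : ∀ i, 0 ≤ x i := fun i => by simpa using hx (Fin.castAdd 2 i)
      refine ⟨fun v => if hv : v ∈ V then x (e.symm ⟨v, hv⟩) else 0, ?_, ?_, ?_⟩
      · intro v hv; simp [hv, hn]
      · rw [← hs, ← e.symm.sum_comp, ← Finset.sum_coe_sort]
        refine Finset.sum_congr rfl fun v _ => ?_
        simp
      · rw [← e.symm.sum_comp, ← Finset.sum_coe_sort]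
        refine Finset.sum_congr rfl fun v _ => ?_
        simp

lemma dist_le_of_coord {d : ℕ} (hd : 1 ≤ d) (x y : EuclideanSpace ℝ (Fin d)) (c : ℝ) (hc : 0 ≤ c)
    (h : ∀ i, |x i - y i| ≤ c) : dist x y ≤ d * c := by
  rw [EuclideanSpace.dist_eq]
  have hd' : (1 : ℝ) ≤ d := by exact_mod_cast hd
  apply Real.sqrt_le_iff.mpr
  refine ⟨by positivity, ?_⟩
  calc ∑ i, dist (x i) (y i) ^ 2 ≤ ∑ i : Fin d, c ^ 2 := by
        apply Finset.sum_le_sum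
        intro i _
        rw [Real.dist_eq]
        exact pow_le_pow_left₀ (abs_nonneg _) (h i) 2
    _ = d * c ^ 2 := by simp
    _ ≤ (d * c) ^ 2 := by nlinarith [sq_nonneg c, mul_nonneg (sub_nonneg.mpr hd') (sq_nonneg c)]

lemma floor_mem (s : ℕ) (v : ℝ) (hv : |v| ≤ 1) : ⌊v * s⌋ ∈ Finset.Icc (-(s : ℤ)) s := by
  have hs : (0 : ℝ) ≤ s := Nat.cast_nonneg s
  have := abs_le.mp hv
  rw [Finset.mem_Icc]
  constructor
  · rw [Int.le_floor]; push_cast; nlinarith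
  · have : ((⌊v * s⌋ : ℤ) : ℝ) ≤ (s : ℝ) := (Int.floor_le _).trans (by nlinarith)
    exact_mod_cast this

lemma floor_close (s : ℕ) (hs : 0 < s) (u v : ℝ) (h : ⌊u * s⌋ = ⌊v * s⌋) : |u - v| ≤ 1 / s := by
  have h1 := Int.abs_sub_lt_one_of_floor_eq_floor h
  have hs' : (0 : ℝ) < s := by exact_mod_cast hs
  rw [← sub_mul, abs_mul, abs_of_pos hs'] at h1
  rw [le_div_iff₀ hs']; exact h1.le

lemma counting {d K n s : ℕ} (hd : 1 ≤ d) (hn : 0 < n) (hs : 0 < s)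
    (F : Finset (Set (EuclideanSpace ℝ (Fin d)))) (ρ Δ : ℝ) (hρ : 0 < ρ)
    (hball : ∀ P ∈ F, P ⊆ Metric.closedBall 0 ρ)
    (hsep : ∀ P ∈ F, ∀ P' ∈ F, P ≠ P' → Δ ≤ Metric.hausdorffDist P P')
    (hD : ∀ P ∈ F, ∃ N p, Descr P K n N p)
    (h1 : (n : ℝ) ^ 2 * K * (1 / s) ≤ 1)
    (h2 : n * (d * (ρ / s)) + 2 * ρ * ((n : ℝ) ^ 2 * K * (1 / s)) < Δ) :
    F.card ≤ (2 * s + 1) ^ (n * (K * K + d)) := by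
  classical
  have hD' : ∀ P : F, ∃ N p, Descr P.1 K n N p := fun P => hD P.1 P.2
  choose N p hDe using hD'
  have hpb : ∀ (P : F) i c, |p P i c / ρ| ≤ 1 := by
    intro P i c
    have a1 := hball _ P.2 ((hDe P).mem i)
    rw [mem_closedBall_zero_iff] at a1
    rw [abs_div, abs_of_pos hρ, div_le_one hρ]
    have := PiLp.norm_apply_le (p P i) c
    rw [Real.norm_eq_abs] at this
    exact this.trans a1
  let I := {z : ℤ // z ∈ Finset.Icc (-(s : ℤ)) s}
  let enc : F → (Fin n × ((Fin K × Fin K) ⊕ Fin d) → I) := fun P q =>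
    match q with
    | (i, Sum.inl (a, b)) => ⟨⌊N P i a b * s⌋, floor_mem s _ (entry_le (hDe P) i a b)⟩
    | (i, Sum.inr c) => ⟨⌊(p P i c / ρ) * s⌋, floor_mem s _ (hpb P i c)⟩
  have hs' : (0 : ℝ) < s := by exact_mod_cast hs
  have hclose : ∀ P P' : F, enc P = enc P' → ∀ x ∈ P.1, ∃ y ∈ P'.1,
      dist x y ≤ n * (d * (ρ / s)) + 2 * ρ * ((n : ℝ) ^ 2 * K * (1 / s)) := by
    intro P P' he
    refine close_points hn (hDe P) (hDe P') ρ (1 / s) (d * (ρ / s)) (hball _ P.2) (hball _ P'.2)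
      (by positivity) (by positivity) ?_ ?_ h1
    · intro i a b
      have := congrArg Subtype.val (congrFun he (i, Sum.inl (a, b)))
      exact floor_close s hs _ _ this.symm
    · intro i
      apply dist_le_of_coord hd _ _ _ (by positivity)
      intro c
      have := congrArg Subtype.val (congrFun he (i, Sum.inr c))
      have := floor_close s hs _ _ this
      rw [← sub_div, abs_div, abs_of_pos hρ, div_le_iff₀ hρ] at this
      calc _ ≤ _ := this
        _ = ρ / s := by ring
  have hinj : Function.Injective enc := by
    intro P P' he
    by_contra hne
    have hne' : P.1 ≠ P'.1 := fun h => hne (Subtype.ext h)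
    have a1 := hsep _ P.2 _ P'.2 hne'
    have a2 : Metric.hausdorffDist P.1 P'.1 ≤ _ :=
      Metric.hausdorffDist_le_of_mem_dist (by positivity) (hclose P P' he) (hclose P' P he.symm)
    linarith
  have := Fintype.card_le_of_injective enc hinj
  have hI : Fintype.card I = 2 * s + 1 := by
    simp only [I, Fintype.card_coe, Int.card_Icc]; omega
  simpa [hI] using this

lemma arith1 (K d r : ℝ) (hK : 1 ≤ K) (hd : 1 ≤ d) (hr : 1 ≤ r) :
    r * (K * K + 1) * (d + 2 * (K * K + 1) * K) + 3 ≤ 256 * (r * d * K ^ 4) ^ 2 := by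
  have hKK : K * K + 1 ≤ 2 * K ^ 2 := by nlinarith
  have h3 : (1 : ℝ) ≤ K ^ 3 := one_le_pow₀ hK
  have a1 : d + 2 * (K * K + 1) * K ≤ 5 * d * K ^ 3 := by
    have : 2 * (K * K + 1) * K ≤ 4 * K ^ 3 := by nlinarith
    nlinarith
  have a2 : r * (K * K + 1) * (d + 2 * (K * K + 1) * K) ≤ (r * (2 * K ^ 2)) * (5 * d * K ^ 3) := by
    gcongr
  have h8 : K ^ 5 ≤ K ^ 8 := pow_le_pow_right₀ hK (by norm_num)
  have h5 : (1 : ℝ) ≤ K ^ 5 := one_le_pow₀ hK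
  have hrd : 1 ≤ r * d := by nlinarith
  have a3 : 1 ≤ r * d * K ^ 5 := by nlinarith
  have a4 : r * d * K ^ 5 ≤ (r * d) ^ 2 * K ^ 8 := by
    have : r * d ≤ (r * d) ^ 2 := by nlinarith
    gcongr
  nlinarith

theorem statement1 (d : ℕ) (F : Finset (Set (EuclideanSpace ℝ (Fin d))))
    (hcard : 2 ≤ F.card)
    (hpoly : ∀ P ∈ F, IsPolytope P)
    (hdim : ∀ P ∈ F, 1 ≤ Module.finrank ℝ (affineSpan ℝ P).direction)
    (ρ Δ : ℝ) (hρ : 0 < ρ) (hΔ : 0 < Δ)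
    (hball : ∀ P ∈ F, P ⊆ Metric.closedBall 0 ρ)
    (hsep : ∀ P ∈ F, ∀ P' ∈ F, P ≠ P' → Δ ≤ Metric.hausdorffDist P P') :
    ∃ P ∈ F,
      (Real.logb 2 F.card /
          (8 * d * (1 + Real.logb 2 (2 * ρ / Δ) + Real.logb 2 (Real.logb 2 F.card))))
          ^ ((1 : ℝ) / 4)
        ≤ (sxc P : ℝ) := by
  classical
  have hFne : F.Nonempty := Finset.card_pos.mp (by omega)
  obtain ⟨P0, hP0⟩ := hFne
  have hd : 1 ≤ d := by
    have h1 := hdim P0 hP0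
    have h2 := Submodule.finrank_le (affineSpan ℝ P0).direction
    rw [finrank_euclideanSpace, Fintype.card_fin] at h2
    omega
  have hne : ∀ P ∈ F, P.Nonempty := by
    intro P hP
    by_contra h
    rw [not_nonempty_iff_eq_empty] at h
    have := hdim P hP
    rw [h] at this
    simp at this
  have hnsub : ∀ P ∈ F, ¬ P.Subsingleton := by
    intro P hP h
    have := hdim P hP
    obtain ⟨x, hx⟩ := hne P hP
    rw [h.eq_singleton_of_mem hx] at this
    rw [direction_affineSpan, vectorSpan_singleton, finrank_bot] at this
    omega
  have hext : ∀ P ∈ F, HasSdpExt P (sxc P) := by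
    intro P hP
    have hh : ¬ (P = ∅ ∨ ∃ p, P = {p}) := by
      rintro (h | ⟨p, h⟩)
      · exact (hne P hP).ne_empty h
      · exact hnsub P hP (h ▸ subsingleton_singleton)
    rw [sxc, if_neg hh]
    exact Nat.sInf_mem (polytope_sdpExt (hpoly P hP))
  have hpos : ∀ P ∈ F, 1 ≤ sxc P := by
    intro P hP
    by_contra h0
    have h0 : sxc P = 0 := by omega
    have h := hext P hP
    rw [h0] at h
    obtain ⟨n, φ, M, hs, hPM⟩ := h
    apply hnsub P hP
    rw [hPM]
    rintro _ ⟨x, hx, rfl⟩ _ ⟨y, hy, rfl⟩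
    exact kernel_eq φ M ρ (hPM ▸ hball P hP) x y (Subsingleton.elim _ _) hx
  by_contra hcon
  push Not at hcon
  obtain ⟨Q, hQ, hKQ⟩ := Finset.exists_mem_eq_sup F ⟨P0, hP0⟩ sxc
  set K := F.sup sxc with hK
  have hK1 : 1 ≤ K := hKQ ▸ hpos Q hQ
  have hKB := hcon Q hQ
  rw [← hKQ] at hKB
  set L := Real.logb 2 F.card with hL
  set r := 2 * ρ / Δ with hr
  have hL1 : 1 ≤ L := by
    rw [hL, Real.le_logb_iff_rpow_le (by norm_num) (by positivity)]
    rw [Real.rpow_one]; exact_mod_cast hcard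
  have hr1 : 1 ≤ r := by
    obtain ⟨A, hA, B, hB, hAB⟩ := Finset.one_lt_card.mp (show 1 < F.card by omega)
    have h1 := hsep A hA B hB hAB
    have hdist : ∀ X ∈ F, ∀ Y ∈ F, ∀ x ∈ X, ∃ y ∈ Y, dist x y ≤ 2 * ρ := by
      intro X hX Y hY x hx
      obtain ⟨y, hy⟩ := hne Y hY
      refine ⟨y, hy, ?_⟩
      have a1 := hball X hX hx
      have a2 := hball Y hY hy
      rw [mem_closedBall] at a1 a2
      exact (dist_triangle_right x y 0).trans (by linarith)
    have h2 := Metric.hausdorffDist_le_of_mem_dist (by positivity) (hdist A hA B hB) (hdist B hB A hA)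
    rw [hr, le_div_iff₀ hΔ]; linarith
  have hlr : 0 ≤ Real.logb 2 r := Real.logb_nonneg (by norm_num) hr1
  have hlL : 0 ≤ Real.logb 2 L := Real.logb_nonneg (by norm_num) hL1
  set T := 1 + Real.logb 2 r + Real.logb 2 L with hT
  have hT1 : 1 ≤ T := by linarith
  have hdR : (1 : ℝ) ≤ d := by exact_mod_cast hd
  have hKR : (1 : ℝ) ≤ K := by exact_mod_cast hK1
  have hmain : 8 * d * (K : ℝ) ^ 4 * T < L := by
    have h4 : (K : ℝ) ^ 4 < L / (8 * d * T) := by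
      have := pow_lt_pow_left₀ hKB (by positivity) (show (4 : ℕ) ≠ 0 by norm_num)
      rw [← Real.rpow_natCast ((L / (8 * d * T)) ^ ((1 : ℝ) / 4)), ← Real.rpow_mul (by positivity)] at this
      norm_num at this
      exact this
    rw [lt_div_iff₀ (by positivity)] at h4
    linarith
  have hL8 : 8 * d * (K : ℝ) ^ 4 ≤ L := by
    have : 0 ≤ 8 * d * (K : ℝ) ^ 4 := by positivity
    nlinarith
  set q : ℝ := r * (K * K + 1) * (d + 2 * (K * K + 1) * K) / 2 with hq
  have hq0 : 0 ≤ q := by positivity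
  set s := ⌊q⌋₊ + 1 with hs
  have hqs : q < s := by rw [hs]; exact_mod_cast Nat.lt_floor_add_one q
  have hsq : (s : ℝ) ≤ q + 1 := by
    rw [hs]; push_cast; linarith [Nat.floor_le hq0]
  have hs0 : (0 : ℝ) < s := by linarith
  have hcount := counting (K := K) (n := K * K + 1) (s := s) hd (Nat.succ_pos _) (Nat.succ_pos _)
    F ρ Δ hρ hball hsep
    (fun P hP => exists_descr P ρ (hpoly P hP) (hne P hP) (hball P hP)
      (sdpExt_mono (Finset.le_sup hP) (hext P hP)))
    (by
      push_cast
      rw [mul_one_div, div_le_one hs0]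
      refine le_trans ?_ hqs.le
      rw [hq]
      have e : r * ((K : ℝ) * K + 1) * (d + 2 * (K * K + 1) * K) / 2
        = r * ((K * K + 1) ^ 2 * K) + r * (K * K + 1) * d / 2 := by ring
      rw [e]
      have e1 : 0 ≤ r * ((K : ℝ) * K + 1) * d / 2 := by positivity
      have e2 : 0 ≤ ((K : ℝ) * K + 1) ^ 2 * K := by positivity
      nlinarith)
    (by
      push_cast
      have e : ((K : ℝ) * K + 1) * (d * (ρ / s)) + 2 * ρ * ((K * K + 1) ^ 2 * K * (1 / s))
          = Δ * (q / s) := by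
        rw [hq, hr]; field_simp
      rw [e]
      have : q / s < 1 := (div_lt_one hs0).mpr hqs
      nlinarith)
  have hX : ((2 * s + 1 : ℕ) : ℝ) ≤ (2 * r * L) ^ 2 := by
    push_cast
    calc (2 : ℝ) * s + 1 ≤ r * (K * K + 1) * (d + 2 * (K * K + 1) * K) + 3 := by
          have : r * (K * K + 1) * (d + 2 * (K * K + 1) * K) = 2 * q := by rw [hq]; ring
          rw [this]; linarith
      _ ≤ 256 * (r * d * K ^ 4) ^ 2 := arith1 _ _ _ hKR hdR hr1
      _ = (2 * r * (8 * d * K ^ 4)) ^ 2 := by ring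
      _ ≤ _ := by gcongr
  have hlogX : Real.logb 2 ((2 * s + 1 : ℕ) : ℝ) ≤ 2 * T := by
    have h1 := Real.logb_le_logb_of_le (b := 2) (by norm_num) (by positivity) hX
    refine h1.trans (le_of_eq ?_)
    rw [Real.logb_pow, Real.logb_mul (by positivity) (by positivity),
      Real.logb_mul (by norm_num) (by positivity), Real.logb_self_eq_one (by norm_num)]
    push_cast; ring
  have hfin : L ≤ ((K * K + 1) * (K * K + d) : ℕ) * (2 * T) := by
    have h1 : (F.card : ℝ) ≤ ((2 * s + 1 : ℕ) : ℝ) ^ ((K * K + 1) * (K * K + d)) := by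
      exact_mod_cast hcount
    have h2 := Real.logb_le_logb_of_le (b := 2) (by norm_num) (by positivity) h1
    rw [Real.logb_pow] at h2
    exact h2.trans (mul_le_mul_of_nonneg_left hlogX (by positivity))
  have hpar : (((K * K + 1) * (K * K + d) : ℕ) : ℝ) ≤ 4 * d * K ^ 4 := by
    push_cast
    have b1 : (K : ℝ) * K + 1 ≤ 2 * K ^ 2 := by nlinarith
    have b2 : (K : ℝ) * K + d ≤ 2 * d * K ^ 2 := by
      have : (1 : ℝ) ≤ K ^ 2 := one_le_pow₀ hKR
      nlinarith
    calc ((K : ℝ) * K + 1) * (K * K + d) ≤ (2 * K ^ 2) * (2 * d * K ^ 2) := by gcongr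
      _ = _ := by ring
  have : (((K * K + 1) * (K * K + d) : ℕ) : ℝ) * (2 * T) ≤ 4 * d * K ^ 4 * (2 * T) := by
    gcongr
  linarith
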